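/- Let n ≥ 2 be an integer, 0 < s < 1, and let f be a real-valued Schwartz function on ℝⁿ. Define u(x,ρ) = c_{n,s} |ρ|^s (f ∗ u_{s,|ρ|})(x) for x ∈ ℝⁿ, ρ ≠ 0, and u(x,0) = f(x). Then for every ε > 0 there exists g ∈ C_c^∞(ℝⁿ × ℝ) such that ∫₀^∞ ∫_{ℝⁿ} ( |∇_x(u−g)(x,ρ)|² + (∂_ρ(u−g)(x,ρ))² ) ρ^{1−s} dx dρ < ε. -/

import Mathlib

noncomputable section
open MeasureTheory Real

/-- The kernel `u_{s,ρ}(x) = (ρ² + |x|²)^{-(n+s)/2}`. -/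
def extKer (n : ℕ) (s ρ : ℝ) (x : EuclideanSpace ℝ (Fin n)) : ℝ :=
  (ρ ^ 2 + ‖x‖ ^ 2) ^ (-(((n : ℝ) + s) / 2))

/-- The normalizing constant `c_{n,s} = (∫ (1+|x|²)^{-(n+s)/2} dx)⁻¹`. -/
def cns (n : ℕ) (s : ℝ) : ℝ :=
  (∫ x : EuclideanSpace ℝ (Fin n), (1 + ‖x‖ ^ 2) ^ (-(((n : ℝ) + s) / 2)))⁻¹

/-- `u(x,ρ) = c_{n,s} |ρ|^s (f ∗ u_{s,|ρ|})(x)` for `ρ ≠ 0`, and `u(x,0) = f(x)`. -/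
def U18 (n : ℕ) (s : ℝ) (f : EuclideanSpace ℝ (Fin n) → ℝ)
    (x : EuclideanSpace ℝ (Fin n)) (ρ : ℝ) : ℝ :=
  if ρ = 0 then f x
  else cns n s * |ρ| ^ s *
    ∫ y : EuclideanSpace ℝ (Fin n), f (x - y) * extKer n s |ρ| y

section Smoothness

variable {E : Type} [NormedAddCommGroup E]

theorem SchwartzMap.exists_norm_le_one_add_norm_rpow [NormedSpace ℝ E] {F : Type*}
    [NormedAddCommGroup F] [NormedSpace ℝ F] (f : SchwartzMap E F) (r : ℝ) :
    ∃ C, 0 ≤ C ∧ ∀ x, ‖f x‖ ≤ C * (1 + ‖x‖) ^ (-r) := by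
  obtain ⟨k, hk⟩ := exists_nat_ge r
  refine ⟨2 ^ k * (Finset.Iic (k, 0)).sup (fun m => SchwartzMap.seminorm ℝ m.1 m.2) f,
    by positivity, fun x => ?_⟩
  have h := SchwartzMap.one_add_le_sup_seminorm_apply (𝕜 := ℝ) (m := (k, 0)) le_rfl le_rfl f x
  rw [norm_iteratedFDeriv_zero] at h
  have h1 : (1 : ℝ) ≤ 1 + ‖x‖ := by linarith [norm_nonneg x]
  have h0 : (0 : ℝ) < 1 + ‖x‖ := by linarith
  have h2 : (1 + ‖x‖) ^ r * ‖f x‖ ≤ (1 + ‖x‖) ^ k * ‖f x‖ := by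
    gcongr
    rw [← Real.rpow_natCast]
    exact Real.rpow_le_rpow_of_exponent_le h1 hk
  rw [Real.rpow_neg h0.le, ← div_eq_mul_inv, le_div_iff₀ (by positivity), mul_comm]
  exact h2.trans h

variable [InnerProductSpace ℝ E] [MeasurableSpace E] [BorelSpace E] [FiniteDimensional ℝ E]

theorem Function.HasTemperateGrowth.fderiv {D G : Type*} [NormedAddCommGroup D] [NormedSpace ℝ D]
    [NormedAddCommGroup G] [NormedSpace ℝ G] {κ : D → G} (hκ : κ.HasTemperateGrowth) :
    (fderiv ℝ κ).HasTemperateGrowth := by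
  refine ⟨(contDiff_infty_iff_fderiv.1 hκ.1).2, fun m => ?_⟩
  obtain ⟨k, C, h⟩ := hκ.2 (m + 1)
  refine ⟨k, C, fun x => ?_⟩
  rw [norm_iteratedFDeriv_fderiv]
  exact h x

variable {D : Type} [NormedAddCommGroup D] [NormedSpace ℝ D]

theorem SchwartzMap.exists_integrable_bound_smul_comp_sub {G : Type*} [NormedAddCommGroup G]
    [NormedSpace ℝ G]
    (ι : E →L[ℝ] D) (f : SchwartzMap E ℝ) {κ : D → G} (hκ : κ.HasTemperateGrowth) (p₀ : D) :
    ∃ B : E → ℝ, Integrable B ∧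
      ∀ y, ∀ p ∈ Metric.ball p₀ 1, ‖f y • κ (p - ι y)‖ ≤ B y := by
  obtain ⟨k, C, hC, hb⟩ := hκ.norm_iteratedFDeriv_le_uniform 0
  obtain ⟨M, hM, hf⟩ := f.exists_norm_le_one_add_norm_rpow
    (k + ((Module.finrank ℝ E : ℝ) + 1))
  refine ⟨fun y => M * (C * (2 + ‖p₀‖ + ‖ι‖) ^ k) * (1 + ‖y‖) ^ (-((Module.finrank ℝ E : ℝ) + 1)),
    (integrable_one_add_norm (by linarith)).const_mul _, fun y p hp => ?_⟩
  have h1 : ‖κ (p - ι y)‖ ≤ C * (1 + ‖p - ι y‖) ^ k := by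
    simpa using hb 0 le_rfl (p - ι y)
  have h2 : ‖p‖ ≤ ‖p₀‖ + 1 := by
    have := norm_le_norm_add_norm_sub' p p₀
    rw [Metric.mem_ball, dist_eq_norm] at hp
    linarith
  have h3 : ‖p - ι y‖ ≤ ‖p₀‖ + 1 + ‖ι‖ * ‖y‖ := by
    refine (norm_sub_le _ _).trans ?_
    have : ‖ι y‖ ≤ ‖ι‖ * ‖y‖ := ι.le_opNorm y
    linarith
  have h4 : (1 + ‖p - ι y‖) ≤ (2 + ‖p₀‖ + ‖ι‖) * (1 + ‖y‖) := by
    nlinarith [norm_nonneg y, norm_nonneg p₀, norm_nonneg ι,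
      mul_nonneg (norm_nonneg y) (norm_nonneg p₀)]
  have hy : (0 : ℝ) < 1 + ‖y‖ := by linarith [norm_nonneg y]
  rw [norm_smul]
  calc ‖f y‖ * ‖κ (p - ι y)‖
      ≤ (M * (1 + ‖y‖) ^ (-(k + ((Module.finrank ℝ E : ℝ) + 1)))) *
        (C * ((2 + ‖p₀‖ + ‖ι‖) * (1 + ‖y‖)) ^ k) := by
        gcongr
        · exact hf y
        · exact h1.trans (by gcongr)
    _ = _ := by
        rw [neg_add, Real.rpow_add hy, Real.rpow_neg hy.le, Real.rpow_natCast, mul_pow]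
        field_simp

theorem SchwartzMap.hasFDerivAt_integral_smul_comp_sub {G : Type} [NormedAddCommGroup G]
    [NormedSpace ℝ G] (ι : E →L[ℝ] D) (f : SchwartzMap E ℝ) {κ : D → G}
    (hκ : κ.HasTemperateGrowth) (p₀ : D) :
    HasFDerivAt (fun p => ∫ y, f y • κ (p - ι y))
      (∫ y, f y • fderiv ℝ κ (p₀ - ι y)) p₀ := by
  have hc : ∀ p, Continuous fun y => f y • κ (p - ι y) := fun p =>
    f.continuous.smul (hκ.1.continuous.comp (continuous_const.sub ι.continuous))
  have hc' : Continuous fun y => f y • fderiv ℝ κ (p₀ - ι y) :=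
    f.continuous.smul (hκ.fderiv.1.continuous.comp (continuous_const.sub ι.continuous))
  obtain ⟨B, hB, hB'⟩ := f.exists_integrable_bound_smul_comp_sub ι hκ.fderiv p₀
  obtain ⟨A, hA, hA'⟩ := f.exists_integrable_bound_smul_comp_sub ι hκ p₀
  refine hasFDerivAt_integral_of_dominated_of_fderiv_le (bound := B)
    (F' := fun p y => f y • fderiv ℝ κ (p - ι y))
    (Metric.ball_mem_nhds p₀ one_pos)
    (.of_forall fun p => (hc p).aestronglyMeasurable) ?_
    hc'.aestronglyMeasurable (.of_forall hB') hB (.of_forall fun y p _ => ?_)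
  · exact hA.mono' (hc p₀).aestronglyMeasurable
      (.of_forall fun y => hA' y p₀ (Metric.mem_ball_self one_pos))
  · have h : HasFDerivAt κ (fderiv ℝ κ (p - ι y)) (p - ι y) :=
      (hκ.1.differentiable (by simp)).differentiableAt.hasFDerivAt
    exact (h.comp p ((hasFDerivAt_id p).sub_const (ι y))).const_smul (f y)

theorem SchwartzMap.contDiff_integral_smul_comp_sub (ι : E →L[ℝ] D) (f : SchwartzMap E ℝ) (m : ℕ) :
    ∀ {G : Type} [NormedAddCommGroup G] [NormedSpace ℝ G] {κ : D → G},
      κ.HasTemperateGrowth → ContDiff ℝ m fun p => ∫ y, f y • κ (p - ι y) := by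
  induction m with
  | zero =>
    intro G _ _ κ hκ
    exact contDiff_zero.2 (Differentiable.continuous (𝕜 := ℝ)
      fun p => (f.hasFDerivAt_integral_smul_comp_sub ι hκ p).differentiableAt)
  | succ m ih =>
    intro G _ _ κ hκ
    rw [Nat.cast_succ, contDiff_succ_iff_fderiv]
    refine ⟨fun p => (f.hasFDerivAt_integral_smul_comp_sub ι hκ p).differentiableAt,
      by simp, ?_⟩
    rw [funext fun p => (f.hasFDerivAt_integral_smul_comp_sub ι hκ p).fderiv]
    exact ih hκ.fderiv

omit [MeasurableSpace E] [BorelSpace E] [FiniteDimensional ℝ E] in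
theorem hasTemperateGrowth_add_sq_rpow {δ : ℝ} (hδ : 0 < δ) (r : ℝ) :
    (fun p : E × ℝ => (p.2 ^ 2 + δ ^ 2 + ‖p.1‖ ^ 2) ^ r).HasTemperateGrowth := by
  have h1 := Function.hasTemperateGrowth_one_add_norm_sq_rpow (WithLp 2 (E × ℝ)) r
  let L : E × ℝ →L[ℝ] WithLp 2 (E × ℝ) :=
    δ⁻¹ • ((WithLp.prodContinuousLinearEquiv 2 ℝ E ℝ).symm : E × ℝ →L[ℝ] WithLp 2 (E × ℝ))
  have h2 := (Function.HasTemperateGrowth.const (E := E × ℝ) ((δ ^ 2) ^ r)).mul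
    (h1.comp L.hasTemperateGrowth)
  refine (congrArg Function.HasTemperateGrowth (funext fun p => ?_)).mpr h2
  have h3 : ‖L p‖ ^ 2 = (‖p.1‖ ^ 2 + p.2 ^ 2) / δ ^ 2 := by
    have : ‖L p‖ ^ 2 = ‖δ⁻¹‖ ^ 2 * ‖WithLp.toLp 2 p‖ ^ 2 := by
      rw [← mul_pow, ← norm_smul]; rfl
    rw [this, WithLp.prod_norm_sq_eq_of_L2]
    simp [field]
  simp only [Pi.mul_apply, Function.comp_apply, h3]
  rw [← Real.mul_rpow (by positivity) (by positivity)]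
  congr 1
  field_simp
  ring

end Smoothness

theorem contDiff_U18_sqrt (n : ℕ) (s : ℝ) (f : SchwartzMap (EuclideanSpace ℝ (Fin n)) ℝ)
    {δ : ℝ} (hδ : 0 < δ) :
    ContDiff ℝ (⊤ : ℕ∞) fun p : EuclideanSpace ℝ (Fin n) × ℝ =>
      U18 n s f p.1 √(p.2 ^ 2 + δ ^ 2) := by
  have h1 : ContDiff ℝ (⊤ : ℕ∞) fun p : EuclideanSpace ℝ (Fin n) × ℝ =>
      ∫ y, f y • ((p - ContinuousLinearMap.inl ℝ _ ℝ y).2 ^ 2 + δ ^ 2 +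
        ‖(p - ContinuousLinearMap.inl ℝ _ ℝ y).1‖ ^ 2) ^ (-(((n : ℝ) + s) / 2)) :=
    contDiff_infty.2 fun m =>
      f.contDiff_integral_smul_comp_sub _ m (hasTemperateGrowth_add_sq_rpow hδ _)
  have h2 : ContDiff ℝ (⊤ : ℕ∞) fun p : EuclideanSpace ℝ (Fin n) × ℝ =>
      √(p.2 ^ 2 + δ ^ 2) :=
    ContDiff.sqrt (by fun_prop) fun p => by positivity
  have h3 : ContDiff ℝ (⊤ : ℕ∞) fun p : EuclideanSpace ℝ (Fin n) × ℝ =>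
      √(p.2 ^ 2 + δ ^ 2) ^ s :=
    h2.rpow_const_of_ne fun p => by positivity
  refine (congrArg (ContDiff ℝ (⊤ : ℕ∞)) (funext fun p => ?_)).mpr
    ((contDiff_const (c := cns n s)).mul (h3.mul h1))
  have hpos : 0 < √(p.2 ^ 2 + δ ^ 2) := by positivity
  rw [U18, if_neg hpos.ne', abs_of_pos hpos, mul_assoc,
    ← integral_sub_left_eq_self _ _ p.1]
  simp only [extKer, Real.sq_sqrt (by positivity : 0 ≤ p.2 ^ 2 + δ ^ 2)]
  simp

theorem contDiffAt_U18 (n : ℕ) (s : ℝ) (f : SchwartzMap (EuclideanSpace ℝ (Fin n)) ℝ)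
    {p : EuclideanSpace ℝ (Fin n) × ℝ} (hp : 0 < p.2) :
    ContDiffAt ℝ (⊤ : ℕ∞) (fun p : EuclideanSpace ℝ (Fin n) × ℝ => U18 n s f p.1 p.2) p := by
  have hδ : 0 < p.2 / 2 := by positivity
  have h1 := contDiff_U18_sqrt n s f hδ
  have h2 : ContDiffAt ℝ (⊤ : ℕ∞) (fun q : EuclideanSpace ℝ (Fin n) × ℝ =>
      (q.1, √(q.2 ^ 2 - (p.2 / 2) ^ 2))) p :=
    contDiffAt_fst.prodMk (ContDiffAt.sqrt (by fun_prop) (by nlinarith))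
  refine (h1.contDiffAt.comp p h2).congr_of_eventuallyEq ?_
  have h3 : ∀ᶠ q : EuclideanSpace ℝ (Fin n) × ℝ in nhds p, p.2 / 2 < q.2 :=
    continuous_snd.continuousAt.eventually (lt_mem_nhds (half_lt_self hp))
  filter_upwards [h3] with q hq
  simp only [Function.comp_apply]
  rw [Real.sq_sqrt (by nlinarith), sub_add_cancel, Real.sqrt_sq (by linarith)]

section RieszPotential

variable {E : Type*} [NormedAddCommGroup E] [InnerProductSpace ℝ E] [MeasurableSpace E]
  [BorelSpace E] [FiniteDimensional ℝ E] [Nontrivial E]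

theorem integrableOn_ball_norm_rpow_neg {b : ℝ} (hb : b < Module.finrank ℝ E) :
    IntegrableOn (fun y : E => ‖y‖ ^ (-b)) (Metric.ball 0 1) := by
  rw [integrableOn_fun_norm_addHaar volume (f := fun t : ℝ => t ^ (-b))]
  have h1 : IntegrableOn (fun t : ℝ => t ^ ((Module.finrank ℝ E : ℝ) - 1 - b)) (Set.Ioo 0 1) :=
    (intervalIntegral.integrableOn_Ioo_rpow_iff one_pos).2 (by linarith)
  refine h1.congr_fun (fun t ht => ?_) measurableSet_Ioo
  have h2 : 1 ≤ Module.finrank ℝ E := Module.finrank_pos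
  simp only [smul_eq_mul]
  rw [sub_eq_add_neg _ b, Real.rpow_add ht.1, ← Real.rpow_natCast, Nat.cast_sub h2, Nat.cast_one]

theorem one_add_norm_rpow_mul_norm_rpow_neg_le {F : Type*} [NormedAddCommGroup F] {b : ℝ}
    (hb : 0 < b) (y : F) :
    (1 + ‖y‖) ^ b * ‖y‖ ^ (-b) ≤
      2 ^ b * (1 + (Metric.ball (0 : F) 1).indicator (fun y => ‖y‖ ^ (-b)) y) := by
  by_cases hy : y ∈ Metric.ball (0 : F) 1
  · rw [Set.indicator_of_mem hy]
    rw [mem_ball_zero_iff] at hy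
    have h1 : (1 + ‖y‖) ^ b ≤ 2 ^ b := by gcongr; linarith
    calc _ ≤ 2 ^ b * ‖y‖ ^ (-b) := by gcongr
      _ ≤ _ := by gcongr; linarith
  · rw [Set.indicator_of_notMem hy]
    rw [mem_ball_zero_iff, not_lt] at hy
    have h0 : 0 < ‖y‖ := by linarith
    rw [Real.rpow_neg h0.le, ← div_eq_mul_inv, ← Real.div_rpow (by positivity) h0.le, add_zero,
      mul_one]
    gcongr
    rw [div_le_iff₀ h0]
    linarith

theorem exists_rieszPotential_bound {b : ℝ} (hb0 : 0 < b) (hb : b < Module.finrank ℝ E) :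
    ∃ C, 0 ≤ C ∧ ∀ x : E,
      Integrable (fun y : E => (1 + ‖x - y‖) ^ (-(b + (Module.finrank ℝ E + 1))) * ‖y‖ ^ (-b)) ∧
      ∫ y : E, (1 + ‖x - y‖) ^ (-(b + (Module.finrank ℝ E + 1))) * ‖y‖ ^ (-b) ≤
        C * (1 + ‖x‖) ^ (-b) := by
  set d : ℝ := (Module.finrank ℝ E : ℝ)
  have hd : 0 ≤ d := Nat.cast_nonneg _
  set χ : E → ℝ := (Metric.ball (0 : E) 1).indicator (fun y => ‖y‖ ^ (-b)) with hχ
  have hχi : Integrable χ := (integrableOn_ball_norm_rpow_neg hb).integrable_indicator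
    measurableSet_ball
  have hχ0 : ∀ y, 0 ≤ χ y := Set.indicator_nonneg fun y _ => by positivity
  have hJ : Integrable fun y : E => (1 + ‖y‖) ^ (-(d + 1)) :=
    integrable_one_add_norm (by linarith)
  have hJx : ∀ x, Integrable fun y : E => (1 + ‖x - y‖) ^ (-(d + 1)) :=
    fun x => hJ.comp_sub_left x
  have key : ∀ x y : E, (1 + ‖x - y‖) ^ (-(b + (d + 1))) * ‖y‖ ^ (-b) ≤
      (1 + ‖x‖) ^ (-b) * (2 ^ b * ((1 + ‖x - y‖) ^ (-(d + 1)) + χ y)) := by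
    intro x y
    have hx : 0 < 1 + ‖x‖ := by positivity
    have hy : 0 < 1 + ‖y‖ := by positivity
    have hxy : 0 < 1 + ‖x - y‖ := by positivity
    have h1 : (1 + ‖x‖) ^ b ≤ (1 + ‖x - y‖) ^ b * (1 + ‖y‖) ^ b := by
      rw [← Real.mul_rpow hxy.le hy.le]
      gcongr
      have : ‖x‖ ≤ ‖x - y‖ + ‖y‖ := by simpa using norm_add_le (x - y) y
      nlinarith [norm_nonneg (x - y), norm_nonneg y]
    have h2 := one_add_norm_rpow_mul_norm_rpow_neg_le hb0 y
    have h3 : (1 + ‖x - y‖) ^ (-(d + 1)) ≤ 1 :=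
      Real.rpow_le_one_of_one_le_of_nonpos (by linarith [norm_nonneg (x - y)]) (by linarith)
    rw [Real.rpow_neg hx.le b, inv_mul_eq_div, le_div_iff₀ (by positivity)]
    calc (1 + ‖x - y‖) ^ (-(b + (d + 1))) * ‖y‖ ^ (-b) * (1 + ‖x‖) ^ b
        ≤ (1 + ‖x - y‖) ^ (-(b + (d + 1))) * ‖y‖ ^ (-b) *
          ((1 + ‖x - y‖) ^ b * (1 + ‖y‖) ^ b) := by gcongr
      _ = (1 + ‖x - y‖) ^ (-(d + 1)) * ((1 + ‖y‖) ^ b * ‖y‖ ^ (-b)) := by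
        rw [neg_add, Real.rpow_add hxy, Real.rpow_neg hxy.le b]
        field_simp
      _ ≤ (1 + ‖x - y‖) ^ (-(d + 1)) * (2 ^ b * (1 + χ y)) := by gcongr
      _ = 2 ^ b * ((1 + ‖x - y‖) ^ (-(d + 1)) + (1 + ‖x - y‖) ^ (-(d + 1)) * χ y) := by ring
      _ ≤ _ := by
        gcongr
        exact mul_le_of_le_one_left (hχ0 y) h3
  have hint : ∀ x, Integrable fun y : E =>
      (1 + ‖x‖) ^ (-b) * (2 ^ b * ((1 + ‖x - y‖) ^ (-(d + 1)) + χ y)) := fun x =>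
    (((hJx x).add hχi).const_mul _).const_mul _
  refine ⟨2 ^ b * ((∫ y : E, (1 + ‖y‖) ^ (-(d + 1))) + ∫ y, χ y), ?_, fun x => ⟨?_, ?_⟩⟩
  · have h1 : 0 ≤ ∫ y : E, (1 + ‖y‖) ^ (-(d + 1)) := integral_nonneg fun y => by positivity
    have h2 : 0 ≤ ∫ y, χ y := integral_nonneg hχ0
    positivity
  · refine (hint x).mono' (by fun_prop) (.of_forall fun y => ?_)
    rw [Real.norm_of_nonneg (by positivity)]
    exact key x y
  · refine (integral_mono_of_nonneg (.of_forall fun y => ?_) (hint x)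
      (.of_forall (key x))).trans_eq ?_
    · positivity
    rw [integral_const_mul, integral_const_mul, integral_add (hJx x) hχi,
      integral_sub_left_eq_self (fun y : E => (1 + ‖y‖) ^ (-(d + 1)))]
    ring

theorem exists_scaled_rieszPotential_bound {b : ℝ} (hb0 : 0 < b)
    (hb : b < Module.finrank ℝ E) :
    ∃ C, 0 ≤ C ∧ ∀ (x : E) (ρ : ℝ), 0 < ρ →
      Integrable (fun z : E =>
        (1 + ‖x - ρ • z‖) ^ (-(b + (Module.finrank ℝ E + 1))) * ‖z‖ ^ (-b)) ∧
      ∫ z : E, (1 + ‖x - ρ • z‖) ^ (-(b + (Module.finrank ℝ E + 1))) * ‖z‖ ^ (-b) ≤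
        C * (ρ ^ (b - Module.finrank ℝ E) * (1 + ‖x‖) ^ (-b)) := by
  obtain ⟨C, hC, h⟩ := exists_rieszPotential_bound hb0 hb
  refine ⟨C, hC, fun x ρ hρ => ?_⟩
  obtain ⟨h1, h2⟩ := h x
  set g : E → ℝ :=
    fun y => (1 + ‖x - y‖) ^ (-(b + (Module.finrank ℝ E + 1))) * ‖y‖ ^ (-b) with hg
  have h3 : (fun z : E =>
      (1 + ‖x - ρ • z‖) ^ (-(b + (Module.finrank ℝ E + 1))) * ‖z‖ ^ (-b)) =
      fun z => ρ ^ b * g (ρ • z) := by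
    funext z
    simp only [hg]
    rw [norm_smul ρ z, Real.norm_of_nonneg hρ.le, Real.mul_rpow hρ.le (norm_nonneg z),
      Real.rpow_neg hρ.le]
    field_simp
  rw [h3]
  refine ⟨((integrable_comp_smul_iff volume g hρ.ne').2 h1).const_mul _, ?_⟩
  rw [integral_const_mul, Measure.integral_comp_smul, smul_eq_mul, abs_of_pos (by positivity),
    Real.rpow_sub hρ, Real.rpow_natCast]
  calc _ ≤ ρ ^ b * ((ρ ^ Module.finrank ℝ E)⁻¹ * (C * (1 + ‖x‖) ^ (-b))) := by gcongr
    _ = _ := by ring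

end RieszPotential

section ScaledAverage

variable {E D : Type} [NormedAddCommGroup E] [InnerProductSpace ℝ E] [MeasurableSpace E]
  [BorelSpace E] [FiniteDimensional ℝ E] [NormedAddCommGroup D] [NormedSpace ℝ D]

omit [MeasurableSpace E] [BorelSpace E] [FiniteDimensional ℝ E] in
theorem norm_sub_smulRight_le (α : D →L[ℝ] E) (σ : D →L[ℝ] ℝ) (z : E) :
    ‖α - σ.smulRight z‖ ≤ (‖α‖ + ‖σ‖) * (1 + ‖z‖) := by
  refine (norm_sub_le _ _).trans ?_
  rw [ContinuousLinearMap.norm_smulRight_apply]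
  nlinarith [norm_nonneg α, norm_nonneg σ, norm_nonneg z,
    mul_nonneg (norm_nonneg α) (norm_nonneg z)]

omit [MeasurableSpace E] [BorelSpace E] [FiniteDimensional ℝ E] in
theorem continuous_smul_fderiv_comp_sub_smulRight (α : D →L[ℝ] E) (σ : D →L[ℝ] ℝ)
    (f : SchwartzMap E ℝ) {Q : E → ℝ} (hQc : Continuous Q) (p : D) :
    Continuous fun z =>
      Q z • (fderiv ℝ f ((α - σ.smulRight z) p)).comp (α - σ.smulRight z) := by
  have h1 : Continuous fun z : E => α - σ.smulRight z :=
    continuous_const.sub (ContinuousLinearMap.smulRightL ℝ D E σ).continuous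
  have h2 : Continuous (fderiv ℝ f) := (f.smooth 1).continuous_fderiv one_ne_zero
  exact hQc.smul ((h2.comp (h1.clm_apply continuous_const)).clm_comp h1)

theorem SchwartzMap.hasFDerivAt_integral_comp_sub_smul (α : D →L[ℝ] E) (σ : D →L[ℝ] ℝ)
    (f : SchwartzMap E ℝ) {Q : E → ℝ} (hQc : Continuous Q) (hQi : Integrable Q)
    (hQ0 : ∀ z, 0 ≤ Q z) {p₀ : D} (hp₀ : 0 < σ p₀) :
    HasFDerivAt (fun p => ∫ z, Q z • f ((α - σ.smulRight z) p))
      (∫ z, Q z • (fderiv ℝ f ((α - σ.smulRight z) p₀)).comp (α - σ.smulRight z)) p₀ := by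
  obtain ⟨M, hM, hf⟩ := (SchwartzMap.fderivCLM ℝ E ℝ f).exists_norm_le_one_add_norm_rpow 1
  obtain ⟨M₀, hM₀, hf₀⟩ := f.exists_norm_le_one_add_norm_rpow 0
  simp only [SchwartzMap.fderivCLM_apply] at hf
  simp only [neg_zero, Real.rpow_zero, mul_one] at hf₀
  set K : ℝ := 1 + 2 / σ p₀ * (1 + (‖α p₀‖ + 1))
  have hK : 0 ≤ K := by positivity
  have hc : ∀ p, Continuous fun z => Q z • f ((α - σ.smulRight z) p) := fun p => by
    have h1 : Continuous fun z : E => α - σ.smulRight z :=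
      continuous_const.sub (ContinuousLinearMap.smulRightL ℝ D E σ).continuous
    exact hQc.smul (f.continuous.comp (h1.clm_apply continuous_const))
  have hs : {p | σ p₀ / 2 < σ p ∧ ‖α p‖ < ‖α p₀‖ + 1} ∈ nhds p₀ :=
    (σ.continuous.continuousAt.eventually (lt_mem_nhds (half_lt_self hp₀))).and
      (α.continuous.norm.continuousAt.eventually (gt_mem_nhds (lt_add_one _)))
  refine hasFDerivAt_integral_of_dominated_of_fderiv_le
    (bound := fun z => Q z * (M * ((‖α‖ + ‖σ‖) * K)))
    (F' := fun p z => Q z • (fderiv ℝ f ((α - σ.smulRight z) p)).comp (α - σ.smulRight z))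
    hs (.of_forall fun p => (hc p).aestronglyMeasurable) ?_
    (continuous_smul_fderiv_comp_sub_smulRight α σ f hQc p₀).aestronglyMeasurable
    (.of_forall fun z p hp => ?_) (hQi.mul_const _) (.of_forall fun z p _ => ?_)
  · refine (hQi.mul_const M₀).mono' (hc p₀).aestronglyMeasurable (.of_forall fun z => ?_)
    rw [norm_smul, Real.norm_of_nonneg (hQ0 z)]
    exact mul_le_mul_of_nonneg_left (hf₀ _) (hQ0 z)
  · set A := α - σ.smulRight z with hA
    have h1 : σ p * ‖z‖ ≤ ‖A p‖ + ‖α p‖ := by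
      have h2 : σ p • z = α p - A p := by simp [hA]
      have h3 : ‖σ p • z‖ = σ p * ‖z‖ := by
        rw [norm_smul, Real.norm_of_nonneg (by linarith [hp.1])]
      rw [← h3, h2, add_comm]
      exact norm_sub_le _ _
    have h2 : 1 + ‖z‖ ≤ K * (1 + ‖A p‖) := by
      have h3 : σ p₀ / 2 * ‖z‖ ≤ ‖A p‖ + (‖α p₀‖ + 1) := by
        have := mul_le_mul_of_nonneg_right hp.1.le (norm_nonneg z)
        linarith [hp.2]
      have h4 : ‖z‖ ≤ 2 / σ p₀ * (‖A p‖ + (‖α p₀‖ + 1)) := by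
        rw [div_mul_eq_mul_div, le_div_iff₀ hp₀]
        linarith
      have h5 : ‖A p‖ + (‖α p₀‖ + 1) ≤ (1 + (‖α p₀‖ + 1)) * (1 + ‖A p‖) := by
        nlinarith [norm_nonneg (A p), norm_nonneg (α p₀),
          mul_nonneg (norm_nonneg (A p)) (norm_nonneg (α p₀))]
      have h6 : 2 / σ p₀ * (‖A p‖ + (‖α p₀‖ + 1)) ≤
          2 / σ p₀ * ((1 + (‖α p₀‖ + 1)) * (1 + ‖A p‖)) := by gcongr
      have : K * (1 + ‖A p‖) =
          1 + ‖A p‖ + 2 / σ p₀ * ((1 + (‖α p₀‖ + 1)) * (1 + ‖A p‖)) := by ring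
      linarith [norm_nonneg (A p)]
    rw [norm_smul, Real.norm_of_nonneg (hQ0 z)]
    refine mul_le_mul_of_nonneg_left ?_ (hQ0 z)
    have h7 : 0 < 1 + ‖A p‖ := by positivity
    calc ‖(fderiv ℝ f (A p)).comp A‖ ≤ ‖fderiv ℝ f (A p)‖ * ‖A‖ :=
          ContinuousLinearMap.opNorm_comp_le _ _
      _ ≤ M * (1 + ‖A p‖) ^ (-1 : ℝ) * ((‖α‖ + ‖σ‖) * (K * (1 + ‖A p‖))) := by
          gcongr
          · exact hf _
          · exact (norm_sub_smulRight_le α σ z).trans (by gcongr)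
      _ = _ := by
          rw [Real.rpow_neg_one]
          field_simp
  · have h : HasFDerivAt f (fderiv ℝ f ((α - σ.smulRight z) p)) ((α - σ.smulRight z) p) :=
      f.differentiableAt.hasFDerivAt
    exact (h.comp p (α - σ.smulRight z).hasFDerivAt).const_smul (Q z)

theorem SchwartzMap.exists_bound_integral_comp_sub_smul [Nontrivial E]
    (α : D →L[ℝ] E) (σ : D →L[ℝ] ℝ) (f : SchwartzMap E ℝ) {Q : E → ℝ} (hQc : Continuous Q)
    (hQi : Integrable Q) (hQ0 : ∀ z, 0 ≤ Q z) {b c : ℝ} (hb0 : 0 < b)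
    (hb : b < Module.finrank ℝ E) (hQ : ∀ z ≠ 0, (1 + ‖z‖) * Q z ≤ c * ‖z‖ ^ (-b)) :
    ∃ C, 0 ≤ C ∧ ∀ p, 0 < σ p →
      ‖∫ z, Q z • f ((α - σ.smulRight z) p)‖ ≤
        C * ((σ p) ^ (b - Module.finrank ℝ E) * (1 + ‖α p‖) ^ (-b)) ∧
      ‖fderiv ℝ (fun p => ∫ z, Q z • f ((α - σ.smulRight z) p)) p‖ ≤
        C * ((σ p) ^ (b - Module.finrank ℝ E) * (1 + ‖α p‖) ^ (-b)) := by
  obtain ⟨M, hM, hf⟩ := (SchwartzMap.fderivCLM ℝ E ℝ f).exists_norm_le_one_add_norm_rpow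
    (b + (Module.finrank ℝ E + 1))
  obtain ⟨M₀, hM₀, hf₀⟩ := f.exists_norm_le_one_add_norm_rpow (b + (Module.finrank ℝ E + 1))
  simp only [SchwartzMap.fderivCLM_apply] at hf
  obtain ⟨C, hC, h⟩ := exists_scaled_rieszPotential_bound (E := E) hb0 hb
  have hne : ∀ᵐ z : E, z ≠ 0 := by
    rw [ae_iff]; simp
  have hc : 0 ≤ c := by
    obtain ⟨z, hz⟩ := exists_ne (0 : E)
    have h1 : 0 < ‖z‖ ^ (-b) := Real.rpow_pos_of_pos (norm_pos_iff.2 hz) _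
    have h2 : 0 ≤ (1 + ‖z‖) * Q z := mul_nonneg (by positivity) (hQ0 z)
    exact nonneg_of_mul_nonneg_left (h2.trans (hQ z hz)) h1
  have key : ∀ (L : ℝ) (x : E) (ρ : ℝ) (_ : 0 < ρ) {G : Type} [NormedAddCommGroup G]
      [NormedSpace ℝ G] (F : E → G), 0 ≤ L →
      (∀ z ≠ 0, ‖F z‖ ≤ L * ((1 + ‖x - ρ • z‖) ^ (-(b + (Module.finrank ℝ E + 1))) * ‖z‖ ^ (-b))) →
      ‖∫ z, F z‖ ≤ L * C * (ρ ^ (b - Module.finrank ℝ E) * (1 + ‖x‖) ^ (-b)) := by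
    intro L x ρ hρ G _ _ F hL hF
    obtain ⟨h1, h2⟩ := h x ρ hρ
    refine (norm_integral_le_of_norm_le (h1.const_mul L)
      (hne.mono fun z hz => hF z hz)).trans ?_
    rw [integral_const_mul, mul_assoc]
    gcongr
  refine ⟨max (M₀ * c * C) (M * (‖α‖ + ‖σ‖) * c * C), by positivity, fun p hp => ⟨?_, ?_⟩⟩
  · refine (key (M₀ * c) (α p) (σ p) hp _ (by positivity) fun z hz => ?_).trans ?_
    · have h1 : Q z ≤ c * ‖z‖ ^ (-b) :=
        (le_mul_of_one_le_left (hQ0 z) (by linarith [norm_nonneg z])).trans (hQ z hz)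
      rw [norm_smul, Real.norm_of_nonneg (hQ0 z)]
      calc Q z * ‖f ((α - σ.smulRight z) p)‖ ≤ c * ‖z‖ ^ (-b) *
            (M₀ * (1 + ‖(α - σ.smulRight z) p‖) ^ (-(b + (Module.finrank ℝ E + 1)))) := by
            gcongr
            exact hf₀ _
        _ = _ := by
            simp only [sub_apply, ContinuousLinearMap.smulRight_apply]
            ring
    · gcongr
      exact le_max_left _ _
  · rw [(f.hasFDerivAt_integral_comp_sub_smul α σ hQc hQi hQ0 hp).fderiv]
    refine (key (M * (‖α‖ + ‖σ‖) * c) (α p) (σ p) hp _ (by positivity) fun z hz => ?_).trans ?_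
    · rw [norm_smul, Real.norm_of_nonneg (hQ0 z)]
      calc Q z * ‖(fderiv ℝ f ((α - σ.smulRight z) p)).comp (α - σ.smulRight z)‖
          ≤ Q z * ((M * (1 + ‖(α - σ.smulRight z) p‖) ^ (-(b + (Module.finrank ℝ E + 1)))) *
            ((‖α‖ + ‖σ‖) * (1 + ‖z‖))) := by
            refine mul_le_mul_of_nonneg_left ?_ (hQ0 z)
            refine (ContinuousLinearMap.opNorm_comp_le _ _).trans ?_
            gcongr
            · exact hf _
            · exact norm_sub_smulRight_le α σ z
        _ = (M * (1 + ‖(α - σ.smulRight z) p‖) ^ (-(b + (Module.finrank ℝ E + 1)))) *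
            (‖α‖ + ‖σ‖) * ((1 + ‖z‖) * Q z) := by ring
        _ ≤ (M * (1 + ‖(α - σ.smulRight z) p‖) ^ (-(b + (Module.finrank ℝ E + 1)))) *
            (‖α‖ + ‖σ‖) * (c * ‖z‖ ^ (-b)) := by
            gcongr ?_ * ?_
            exact hQ z hz
        _ = _ := by
            simp only [sub_apply, ContinuousLinearMap.smulRight_apply]
            ring
    · gcongr
      exact le_max_right _ _

end ScaledAverage

theorem U18_eq_integral_comp_sub_smul (n : ℕ) (s : ℝ) (f : EuclideanSpace ℝ (Fin n) → ℝ)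
    (x : EuclideanSpace ℝ (Fin n)) {ρ : ℝ} (hρ : 0 < ρ) :
    U18 n s f x ρ = cns n s * ∫ z : EuclideanSpace ℝ (Fin n),
      (1 + ‖z‖ ^ 2) ^ (-(((n : ℝ) + s) / 2)) • f (x - ρ • z) := by
  have h1 : ∀ z : EuclideanSpace ℝ (Fin n), (1 + ‖z‖ ^ 2) ^ (-(((n : ℝ) + s) / 2)) • f (x - ρ • z)
      = ρ ^ ((n : ℝ) + s) * (f (x - ρ • z) * extKer n s |ρ| (ρ • z)) := fun z => by
    have h2 : extKer n s |ρ| (ρ • z) =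
        ρ ^ (-((n : ℝ) + s)) * (1 + ‖z‖ ^ 2) ^ (-(((n : ℝ) + s) / 2)) := by
      rw [extKer, norm_smul ρ z, Real.norm_of_nonneg hρ.le, abs_of_pos hρ,
        show ρ ^ 2 + (ρ * ‖z‖) ^ 2 = ρ ^ 2 * (1 + ‖z‖ ^ 2) by ring,
        Real.mul_rpow (by positivity) (by positivity), ← Real.rpow_natCast_mul hρ.le]
      congr 2
      push_cast
      ring
    rw [h2, Real.rpow_neg hρ.le, smul_eq_mul]
    have := Real.rpow_pos_of_pos hρ ((n : ℝ) + s)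
    field_simp
  simp_rw [h1]
  rw [integral_const_mul,
    Measure.integral_comp_smul volume (fun y => f (x - y) * extKer n s |ρ| y),
    U18, if_neg hρ.ne', finrank_euclideanSpace_fin, abs_of_pos hρ,
    abs_of_pos (by positivity), smul_eq_mul, mul_assoc (cns n s), Real.rpow_add hρ,
    Real.rpow_natCast]
  field_simp

theorem one_add_norm_mul_rpow_neg_le {F : Type*} [NormedAddCommGroup F] {a b : ℝ}
    (hb0 : 0 ≤ b) (hb : b ≤ 2 * a - 1) {z : F} (hz : z ≠ 0) :
    (1 + ‖z‖) * (1 + ‖z‖ ^ 2) ^ (-a) ≤ 2 * ‖z‖ ^ (-b) := by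
  have hz : 0 < ‖z‖ := norm_pos_iff.2 hz
  have h0 : 0 < 1 + ‖z‖ ^ 2 := by positivity
  have h1 : 1 + ‖z‖ ≤ 2 * (1 + ‖z‖ ^ 2) ^ (1 / 2 : ℝ) := by
    rw [← Real.sqrt_eq_rpow]
    have h2 : 1 ≤ √(1 + ‖z‖ ^ 2) := Real.one_le_sqrt.2 (by nlinarith)
    have h3 : ‖z‖ ≤ √(1 + ‖z‖ ^ 2) := Real.le_sqrt_of_sq_le (by linarith)
    linarith
  calc (1 + ‖z‖) * (1 + ‖z‖ ^ 2) ^ (-a)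
      ≤ 2 * (1 + ‖z‖ ^ 2) ^ (1 / 2 : ℝ) * (1 + ‖z‖ ^ 2) ^ (-a) := by gcongr
    _ = 2 * (1 + ‖z‖ ^ 2) ^ (1 / 2 - a) := by
      rw [mul_assoc, ← Real.rpow_add h0, sub_eq_add_neg]
    _ ≤ 2 * (1 + ‖z‖ ^ 2) ^ (-b / 2) := by
      gcongr
      · nlinarith
      · linarith
    _ ≤ 2 * (‖z‖ ^ 2) ^ (-b / 2) := by
      gcongr 2 * ?_
      exact Real.rpow_le_rpow_of_nonpos (by positivity) (by linarith) (by linarith)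
    _ = _ := by
      rw [← Real.rpow_natCast_mul hz.le]
      congr 2
      push_cast
      ring

theorem exists_bound_U18 (n : ℕ) [NeZero n] {s b : ℝ} (hs : 0 < s)
    (f : SchwartzMap (EuclideanSpace ℝ (Fin n)) ℝ) (hb0 : 0 < b) (hbn : b < n)
    (hbs : b ≤ n + s - 1) :
    ∃ C, 0 ≤ C ∧ ∀ p : EuclideanSpace ℝ (Fin n) × ℝ, 0 < p.2 →
      ‖U18 n s f p.1 p.2‖ ≤ C * (p.2 ^ (b - n) * (1 + ‖p.1‖) ^ (-b)) ∧
      ‖fderiv ℝ (fun p : EuclideanSpace ℝ (Fin n) × ℝ => U18 n s f p.1 p.2) p‖ ≤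
        C * (p.2 ^ (b - n) * (1 + ‖p.1‖) ^ (-b)) := by
  have hfr : Module.finrank ℝ (EuclideanSpace ℝ (Fin n)) = n := finrank_euclideanSpace_fin
  have : Nontrivial (EuclideanSpace ℝ (Fin n)) :=
    Module.nontrivial_of_finrank_pos (R := ℝ) (hfr.trans_gt (Nat.pos_of_neZero n))
  set Q : EuclideanSpace ℝ (Fin n) → ℝ := fun z => (1 + ‖z‖ ^ 2) ^ (-(((n : ℝ) + s) / 2)) with hQ
  have hQc : Continuous Q := Continuous.rpow_const (by fun_prop) fun z => .inl (by positivity)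
  have hQi : Integrable Q := by
    have := integrable_rpow_neg_one_add_norm_sq (E := EuclideanSpace ℝ (Fin n)) (μ := volume)
      (r := n + s) (by rw [hfr]; linarith)
    simpa only [hQ, neg_div] using this
  set α := ContinuousLinearMap.fst ℝ (EuclideanSpace ℝ (Fin n)) ℝ
  set σ := ContinuousLinearMap.snd ℝ (EuclideanSpace ℝ (Fin n)) ℝ
  obtain ⟨C, hC, h⟩ := f.exists_bound_integral_comp_sub_smul α σ hQc hQi
    (fun z => by positivity) hb0 (by rw [hfr]; exact hbn) (c := 2)
    fun z hz => one_add_norm_mul_rpow_neg_le hb0.le (by linarith) hz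
  rw [hfr] at h
  refine ⟨‖cns n s‖ * C, by positivity, fun p hp => ?_⟩
  obtain ⟨h1, h2⟩ := h p hp
  have h3 : ∀ q : EuclideanSpace ℝ (Fin n) × ℝ, 0 < q.2 →
      U18 n s f q.1 q.2 = cns n s • ∫ z, Q z • f ((α - σ.smulRight z) q) :=
    fun q hq => U18_eq_integral_comp_sub_smul n s f q.1 hq
  have h4 : (fun q : EuclideanSpace ℝ (Fin n) × ℝ => U18 n s f q.1 q.2) =ᶠ[nhds p]
      cns n s • fun q => ∫ z, Q z • f ((α - σ.smulRight z) q) :=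
    (continuous_snd.continuousAt.eventually (lt_mem_nhds hp)).mono h3
  have h5 : DifferentiableAt ℝ (fun q => ∫ z, Q z • f ((α - σ.smulRight z) q)) p :=
    (f.hasFDerivAt_integral_comp_sub_smul α σ hQc hQi (fun z => by positivity)
      hp).differentiableAt
  rw [h3 p hp, h4.fderiv_eq, fderiv_const_smul h5, norm_smul, norm_smul, mul_assoc]
  exact ⟨by gcongr; exact h1, by gcongr; exact h2⟩

theorem Filter.Tendsto.clm_comp {ι D F G : Type*} [NormedAddCommGroup D] [NormedSpace ℝ D]
    [NormedAddCommGroup F] [NormedSpace ℝ F] [NormedAddCommGroup G] [NormedSpace ℝ G]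
    {l : Filter ι} {A : ι → F →L[ℝ] G} {B : ι → D →L[ℝ] F} {A₀ : F →L[ℝ] G} {B₀ : D →L[ℝ] F}
    (hA : Filter.Tendsto A l (nhds A₀)) (hB : Filter.Tendsto B l (nhds B₀)) :
    Filter.Tendsto (fun k => (A k).comp (B k)) l (nhds (A₀.comp B₀)) :=
  (isBoundedBilinearMap_comp.continuous.tendsto (A₀, B₀)).comp (hA.prodMk_nhds hB)

section Cutoff

variable {E : Type*} [NormedAddCommGroup E] [NormedSpace ℝ E]

theorem norm_fst_prod_smul_snd_le {c : ℝ} (hc : |c| ≤ 1) :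
    ‖(ContinuousLinearMap.fst ℝ E ℝ).prod (c • ContinuousLinearMap.snd ℝ E ℝ)‖ ≤ 1 := by
  rw [ContinuousLinearMap.opNorm_prod]
  refine max_le (ContinuousLinearMap.norm_fst_le ℝ E ℝ) ?_
  rw [norm_smul]
  exact mul_le_one₀ hc (norm_nonneg _) (ContinuousLinearMap.norm_snd_le ℝ E ℝ)

theorem hasFDerivAt_prodMk_sqrt_sq_add {δ : ℝ} (hδ : 0 < δ) (p : E × ℝ) :
    HasFDerivAt (fun p : E × ℝ => (p.1, √(p.2 ^ 2 + δ ^ 2)))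
      ((ContinuousLinearMap.fst ℝ E ℝ).prod
        ((p.2 / √(p.2 ^ 2 + δ ^ 2)) • ContinuousLinearMap.snd ℝ E ℝ)) p := by
  have h1 : HasDerivAt (fun r : ℝ => √(r ^ 2 + δ ^ 2)) (p.2 / √(p.2 ^ 2 + δ ^ 2)) p.2 := by
    have := (((hasDerivAt_id p.2).pow 2).add_const (δ ^ 2)).sqrt (by simp; positivity)
    refine this.congr_deriv ?_
    simp
    field_simp
  exact hasFDerivAt_fst.prodMk (h1.comp_hasFDerivAt p hasFDerivAt_snd)

variable {W : E × ℝ → ℝ} (hW : ∀ p : E × ℝ, 0 < p.2 → ContDiffAt ℝ (⊤ : ℕ∞) W p)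

include hW

theorem hasFDerivAt_comp_prodMk_sqrt {δ : ℝ} (hδ : 0 < δ) (p : E × ℝ) :
    HasFDerivAt (fun p : E × ℝ => W (p.1, √(p.2 ^ 2 + δ ^ 2)))
      ((fderiv ℝ W (p.1, √(p.2 ^ 2 + δ ^ 2))).comp ((ContinuousLinearMap.fst ℝ E ℝ).prod
        ((p.2 / √(p.2 ^ 2 + δ ^ 2)) • ContinuousLinearMap.snd ℝ E ℝ))) p :=
  have h : HasFDerivAt W (fderiv ℝ W (p.1, √(p.2 ^ 2 + δ ^ 2))) (p.1, √(p.2 ^ 2 + δ ^ 2)) :=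
    ((hW _ (by positivity)).differentiableAt (by simp)).hasFDerivAt
  h.comp p (hasFDerivAt_prodMk_sqrt_sq_add hδ p)

theorem tendsto_comp_prodMk_sqrt {δ : ℕ → ℝ} (hδ0 : ∀ k, 0 < δ k)
    (hδ : Filter.Tendsto δ Filter.atTop (nhds 0)) {p : E × ℝ} (hp : 0 < p.2) :
    Filter.Tendsto (fun k => W (p.1, √(p.2 ^ 2 + δ k ^ 2))) Filter.atTop (nhds (W p)) ∧
    Filter.Tendsto (fun k => fderiv ℝ (fun p : E × ℝ => W (p.1, √(p.2 ^ 2 + δ k ^ 2))) p)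
      Filter.atTop (nhds (fderiv ℝ W p)) := by
  have h1 : Filter.Tendsto (fun k => √(p.2 ^ 2 + δ k ^ 2)) Filter.atTop (nhds p.2) := by
    have := ((hδ.pow 2).const_add (p.2 ^ 2)).sqrt
    simpa [Real.sqrt_sq hp.le] using this
  have h2 : Filter.Tendsto (fun k => (p.1, √(p.2 ^ 2 + δ k ^ 2))) Filter.atTop (nhds p) :=
    tendsto_const_nhds.prodMk_nhds h1
  refine ⟨(hW p hp).continuousAt.tendsto.comp h2, ?_⟩
  have h3 : Filter.Tendsto (fun k => fderiv ℝ W (p.1, √(p.2 ^ 2 + δ k ^ 2))) Filter.atTop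
      (nhds (fderiv ℝ W p)) :=
    ((hW p hp).continuousAt_fderiv (by simp)).tendsto.comp h2
  have h4 : ∀ c : ℝ, (ContinuousLinearMap.fst ℝ E ℝ).prod (c • ContinuousLinearMap.snd ℝ E ℝ) =
      ContinuousLinearMap.id ℝ (E × ℝ) + (c - 1) • (ContinuousLinearMap.inr ℝ E ℝ).comp
        (ContinuousLinearMap.snd ℝ E ℝ) := by
    intro c
    ext <;> simp
  have h5 : Filter.Tendsto (fun k => ContinuousLinearMap.id ℝ (E × ℝ) +
      (p.2 / √(p.2 ^ 2 + δ k ^ 2) - 1) • (ContinuousLinearMap.inr ℝ E ℝ).comp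
        (ContinuousLinearMap.snd ℝ E ℝ)) Filter.atTop
      (nhds (ContinuousLinearMap.id ℝ (E × ℝ))) := by
    have := ((((tendsto_const_nhds (x := p.2)).div h1 hp.ne').sub_const 1).smul_const
      ((ContinuousLinearMap.inr ℝ E ℝ).comp (ContinuousLinearMap.snd ℝ E ℝ))).const_add
        (ContinuousLinearMap.id ℝ (E × ℝ))
    simpa [div_self hp.ne'] using this
  simp_rw [fun k => (hasFDerivAt_comp_prodMk_sqrt hW (hδ0 k) p).fderiv, h4]
  simpa using h3.clm_comp h5

theorem norm_comp_prodMk_sqrt_le {β : ℝ → ℝ} (hβ : AntitoneOn β (Set.Ioi 0)) {w : E → ℝ}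
    (hw : ∀ x, 0 ≤ w x)
    (hb : ∀ p : E × ℝ, 0 < p.2 → ‖W p‖ ≤ β p.2 * w p.1 ∧ ‖fderiv ℝ W p‖ ≤ β p.2 * w p.1)
    {δ : ℝ} (hδ : 0 < δ) {p : E × ℝ} (hp : 0 < p.2) :
    ‖W (p.1, √(p.2 ^ 2 + δ ^ 2))‖ ≤ β p.2 * w p.1 ∧
    ‖fderiv ℝ (fun p : E × ℝ => W (p.1, √(p.2 ^ 2 + δ ^ 2))) p‖ ≤ β p.2 * w p.1 := by
  have h1 : p.2 ≤ √(p.2 ^ 2 + δ ^ 2) := Real.le_sqrt_of_sq_le (by nlinarith)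
  have h0 : 0 < √(p.2 ^ 2 + δ ^ 2) := by positivity
  have h2 : β √(p.2 ^ 2 + δ ^ 2) * w p.1 ≤ β p.2 * w p.1 :=
    mul_le_mul_of_nonneg_right (hβ hp h0 h1) (hw _)
  obtain ⟨h3, h4⟩ := hb (p.1, √(p.2 ^ 2 + δ ^ 2)) h0
  refine ⟨h3.trans h2, ?_⟩
  rw [(hasFDerivAt_comp_prodMk_sqrt hW hδ p).fderiv]
  refine (ContinuousLinearMap.opNorm_comp_le _ _).trans
    ((mul_le_of_le_one_right (norm_nonneg _) (norm_fst_prod_smul_snd_le ?_)).trans (h4.trans h2))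
  rw [abs_of_nonneg (by positivity)]
  exact div_le_one_of_le₀ h1 h0.le

omit hW in
theorem hasFDerivAt_comp_smul_mul {χ V : E × ℝ → ℝ} (hχ : ContDiff ℝ (⊤ : ℕ∞) χ)
    (hV : ContDiff ℝ (⊤ : ℕ∞) V) (t : ℝ) (p : E × ℝ) :
    HasFDerivAt (fun p => χ (t • p) * V p)
      (χ (t • p) • fderiv ℝ V p + V p • t • fderiv ℝ χ (t • p)) p := by
  have h1 : HasFDerivAt V (fderiv ℝ V p) p :=
    (hV.differentiable (by simp)).differentiableAt.hasFDerivAt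
  have h2 : HasFDerivAt χ (fderiv ℝ χ (t • p)) (t • p) :=
    (hχ.differentiable (by simp)).differentiableAt.hasFDerivAt
  have h3 := h2.comp p ((hasFDerivAt_id p).const_smul t)
  refine (h3.mul h1).congr_fderiv ?_
  ext <;> simp

theorem exists_contDiff_hasCompactSupport_approx [FiniteDimensional ℝ E]
    (hV : ∀ δ : ℝ, 0 < δ → ContDiff ℝ (⊤ : ℕ∞) fun p : E × ℝ => W (p.1, √(p.2 ^ 2 + δ ^ 2)))
    {β : ℝ → ℝ} (hβ : AntitoneOn β (Set.Ioi 0)) {w : E → ℝ} (hw : ∀ x, 0 ≤ w x)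
    (hb : ∀ p : E × ℝ, 0 < p.2 → ‖W p‖ ≤ β p.2 * w p.1 ∧ ‖fderiv ℝ W p‖ ≤ β p.2 * w p.1) :
    ∃ (C : ℝ) (g : ℕ → E × ℝ → ℝ),
      (∀ k, ContDiff ℝ (⊤ : ℕ∞) (g k)) ∧ (∀ k, HasCompactSupport (g k)) ∧
      ∀ p : E × ℝ, 0 < p.2 →
        (∀ k, ‖fderiv ℝ (fun p => W p - g k p) p‖ ≤ C * (β p.2 * w p.1)) ∧
        Filter.Tendsto (fun k => ‖fderiv ℝ (fun p => W p - g k p) p‖) Filter.atTop (nhds 0) := by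
  let χ : ContDiffBump (0 : E × ℝ) := ⟨1, 2, one_pos, one_lt_two⟩
  have hχ : ContDiff ℝ (⊤ : ℕ∞) χ := χ.contDiff
  have hχ' : Continuous (fderiv ℝ χ) := hχ.continuous_fderiv (by simp)
  obtain ⟨M, hM⟩ := hχ'.bounded_above_of_compact_support (χ.hasCompactSupport.fderiv ℝ)
  have hM0 : 0 ≤ M := (norm_nonneg _).trans (hM 0)
  let δ : ℕ → ℝ := fun k => 1 / ((k : ℝ) + 1)
  have hδ0 : ∀ k, 0 < δ k := fun k => Nat.one_div_pos_of_nat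
  have hδ1 : ∀ k, δ k ≤ 1 := fun k => by
    simpa [δ] using Nat.one_div_le_one_div (α := ℝ) (Nat.zero_le k)
  have hδ : Filter.Tendsto δ Filter.atTop (nhds 0) := tendsto_one_div_add_atTop_nhds_zero_nat
  let g : ℕ → E × ℝ → ℝ := fun k p => χ (δ k • p) * W (p.1, √(p.2 ^ 2 + δ k ^ 2))
  have hg : ∀ k p, HasFDerivAt (g k) _ p := fun k p =>
    hasFDerivAt_comp_smul_mul hχ (hV _ (hδ0 k)) (δ k) p
  have hWg : ∀ k (p : E × ℝ), 0 < p.2 →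
      fderiv ℝ (fun p => W p - g k p) p = fderiv ℝ W p - fderiv ℝ (g k) p := fun k p hp =>
    fderiv_fun_sub ((hW p hp).differentiableAt (by simp)) (hg k p).differentiableAt
  refine ⟨1 + (1 + M), g, fun k => ?_, fun k => ?_, fun p hp => ⟨fun k => ?_, ?_⟩⟩
  · exact (hχ.comp (contDiff_const_smul (δ k))).mul (hV _ (hδ0 k))
  · exact (χ.hasCompactSupport.comp_smul (hδ0 k).ne').mul_right
  · rw [hWg k p hp, (hg k p).fderiv]
    obtain ⟨h1, h2⟩ := norm_comp_prodMk_sqrt_le hW hβ hw hb (hδ0 k) hp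
    have h0 : 0 ≤ β p.2 * w p.1 := (norm_nonneg _).trans h1
    have h3 : ‖χ (δ k • p)‖ ≤ 1 := by
      rw [Real.norm_of_nonneg χ.nonneg]
      exact χ.le_one
    refine (norm_sub_le _ _).trans ?_
    rw [add_mul, one_mul, add_mul, one_mul]
    refine add_le_add (hb p hp).2 ((norm_add_le _ _).trans (add_le_add ?_ ?_))
    · rw [norm_smul]
      exact (mul_le_of_le_one_left (norm_nonneg _) h3).trans h2
    · rw [norm_smul, norm_smul, Real.norm_of_nonneg (hδ0 k).le, mul_comm]
      exact mul_le_mul ((mul_le_of_le_one_left (norm_nonneg _) (hδ1 k)).trans (hM _)) h1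
        (norm_nonneg _) hM0
  · obtain ⟨h1, h2⟩ := tendsto_comp_prodMk_sqrt hW hδ0 hδ hp
    have h3 : Filter.Tendsto (fun k => δ k • p) Filter.atTop (nhds 0) := by
      simpa using hδ.smul_const p
    have h4 : Filter.Tendsto (fun k => χ (δ k • p)) Filter.atTop (nhds 1) := by
      have := (hχ.continuous.tendsto 0).comp h3
      rwa [χ.one_of_mem_closedBall (by simp [χ])] at this
    have h5 := (hχ'.tendsto 0).comp h3
    have h6 := (h4.smul h2).add (h1.smul (hδ.smul h5))
    rw [zero_smul, smul_zero, add_zero, one_smul] at h6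
    have h7 := (h6.const_sub (fderiv ℝ W p)).norm
    rw [sub_self, norm_zero] at h7
    refine h7.congr fun k => ?_
    rw [hWg k p hp, (hg k p).fderiv]
    rfl

omit hW in
theorem norm_sq_fderiv_add_sq_deriv_le {G : E × ℝ → ℝ} {x : E} {ρ : ℝ}
    (hG : DifferentiableAt ℝ G (x, ρ)) :
    ‖fderiv ℝ (fun x' => G (x', ρ)) x‖ ^ 2 + (deriv (fun r => G (x, r)) ρ) ^ 2 ≤
      2 * ‖fderiv ℝ G (x, ρ)‖ ^ 2 := by
  have h1 : HasFDerivAt (fun x' => G (x', ρ))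
      ((fderiv ℝ G (x, ρ)).comp (ContinuousLinearMap.inl ℝ E ℝ)) x :=
    hG.hasFDerivAt.comp x (hasFDerivAt_prodMk_left x ρ)
  have h2 : HasDerivAt (fun r => G (x, r)) (fderiv ℝ G (x, ρ) (0, 1)) ρ :=
    hG.hasFDerivAt.comp_hasDerivAt ρ ((hasDerivAt_const ρ x).prodMk (hasDerivAt_id ρ))
  have h3 : ‖(fderiv ℝ G (x, ρ)).comp (ContinuousLinearMap.inl ℝ E ℝ)‖ ≤ ‖fderiv ℝ G (x, ρ)‖ :=
    (ContinuousLinearMap.opNorm_comp_le _ _).trans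
      (mul_le_of_le_one_right (norm_nonneg _) (ContinuousLinearMap.norm_inl_le_one ℝ E ℝ))
  have h4 : |fderiv ℝ G (x, ρ) (0, 1)| ≤ ‖fderiv ℝ G (x, ρ)‖ := by
    simpa using (fderiv ℝ G (x, ρ)).le_opNorm (0, 1)
  rw [h1.fderiv, h2.deriv, two_mul, ← sq_abs (fderiv ℝ G (x, ρ) (0, 1))]
  gcongr

theorem exists_contDiff_hasCompactSupport_integral_lt [FiniteDimensional ℝ E] [MeasurableSpace E]
    [BorelSpace E] {μ : Measure E} [SFinite μ]
    (hV : ∀ δ : ℝ, 0 < δ → ContDiff ℝ (⊤ : ℕ∞) fun p : E × ℝ => W (p.1, √(p.2 ^ 2 + δ ^ 2)))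
    {β : ℝ → ℝ} (hβ : AntitoneOn β (Set.Ioi 0)) {w : E → ℝ} (hw : ∀ x, 0 ≤ w x)
    (hb : ∀ p : E × ℝ, 0 < p.2 → ‖W p‖ ≤ β p.2 * w p.1 ∧ ‖fderiv ℝ W p‖ ≤ β p.2 * w p.1)
    {ω : ℝ → ℝ} (hω : Measurable ω) (hω0 : ∀ ρ, 0 < ρ → 0 ≤ ω ρ)
    (hβi : IntegrableOn (fun ρ => β ρ ^ 2 * ω ρ) (Set.Ioi 0))
    (hwi : Integrable (fun x => w x ^ 2) μ) {ε : ℝ} (hε : 0 < ε) :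
    ∃ g : E × ℝ → ℝ, ContDiff ℝ (⊤ : ℕ∞) g ∧ HasCompactSupport g ∧
      ∫ ρ in Set.Ioi (0 : ℝ), ∫ x, (‖fderiv ℝ (fun x' => W (x', ρ) - g (x', ρ)) x‖ ^ 2 +
        (deriv (fun r => W (x, r) - g (x, r)) ρ) ^ 2) * ω ρ ∂μ < ε := by
  obtain ⟨C, g, hg, hgc, h⟩ := exists_contDiff_hasCompactSupport_approx hW hV hβ hw hb
  let H : ℕ → ℝ × E → ℝ := fun k q =>
    2 * ‖fderiv ℝ (fun p => W p - g k p) (q.2, q.1)‖ ^ 2 * ω q.1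
  have hH : ∀ k, Measurable (H k) := fun k =>
    ((((measurable_fderiv ℝ (fun p => W p - g k p)).norm.comp measurable_swap).pow_const
      2).const_mul 2).mul (hω.comp measurable_fst)
  have hae : ∀ᵐ q ∂(volume.restrict (Set.Ioi (0 : ℝ))).prod μ, 0 < q.1 :=
    Measure.quasiMeasurePreserving_fst.ae (ae_restrict_mem measurableSet_Ioi)
  have hB : Integrable (fun q : ℝ × E => 2 * C ^ 2 * ((β q.1 ^ 2 * ω q.1) * w q.2 ^ 2))
      ((volume.restrict (Set.Ioi (0 : ℝ))).prod μ) :=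
    (Integrable.mul_prod hβi hwi).const_mul _
  have hHB : ∀ k, ∀ᵐ q ∂(volume.restrict (Set.Ioi (0 : ℝ))).prod μ,
      ‖H k q‖ ≤ 2 * C ^ 2 * ((β q.1 ^ 2 * ω q.1) * w q.2 ^ 2) := fun k =>
    hae.mono fun q hq => by
      have h1 := (h (q.2, q.1) hq).1 k
      have h2 := hω0 _ hq
      rw [Real.norm_of_nonneg (by positivity)]
      calc H k q ≤ 2 * (C * (β q.1 * w q.2)) ^ 2 * ω q.1 := by
            simp only [H]
            gcongr
        _ = _ := by ring
  have hHi : ∀ k, Integrable (H k) ((volume.restrict (Set.Ioi (0 : ℝ))).prod μ) := fun k =>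
    hB.mono' (hH k).aestronglyMeasurable (hHB k)
  have hlim : Filter.Tendsto (fun k => ∫ q, H k q ∂(volume.restrict (Set.Ioi (0 : ℝ))).prod μ)
      Filter.atTop (nhds 0) := by
    have := tendsto_integral_of_dominated_convergence (f := fun _ => (0 : ℝ)) _
      (fun k => (hH k).aestronglyMeasurable) hB hHB (hae.mono fun q hq => by
        have h1 := (((h (q.2, q.1) hq).2.pow 2).const_mul 2).mul_const (ω q.1)
        simpa using h1)
    simpa using this
  obtain ⟨k, hk⟩ := (hlim.eventually (gt_mem_nhds hε)).exists
  refine ⟨g k, hg k, hgc k, lt_of_le_of_lt ?_ hk⟩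
  rw [integral_prod _ (hHi k)]
  refine integral_mono_of_nonneg ?_ (hHi k).integral_prod_left ?_
  · filter_upwards [ae_restrict_mem measurableSet_Ioi] with ρ hρ
    have := hω0 ρ hρ
    exact integral_nonneg fun x => by positivity
  · filter_upwards [ae_restrict_mem measurableSet_Ioi, (hHi k).prod_right_ae] with ρ hρ hi
    have h0 := hω0 ρ hρ
    refine integral_mono_of_nonneg (.of_forall fun x => by positivity) hi (.of_forall fun x => ?_)
    refine mul_le_mul_of_nonneg_right ?_ h0
    exact norm_sq_fderiv_add_sq_deriv_le (G := fun p => W p - g k p)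
      (((hW (x, ρ) hρ).differentiableAt (by simp)).sub
        ((hg k).differentiable (by simp)).differentiableAt)

end Cutoff

theorem integrableOn_min_rpow_sq_mul_rpow {c d e : ℝ} (hc : -1 < 2 * c + e) (hd : 2 * d + e < -1) :
    IntegrableOn (fun ρ : ℝ => min (ρ ^ c) (ρ ^ d) ^ 2 * ρ ^ e) (Set.Ioi 0) := by
  have hm : Measurable fun ρ : ℝ => min (ρ ^ c) (ρ ^ d) ^ 2 * ρ ^ e := by fun_prop
  have hsq : ∀ (a : ℝ) {ρ : ℝ}, 0 < ρ → (ρ ^ a) ^ 2 * ρ ^ e = ρ ^ (2 * a + e) := fun a ρ hρ => by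
    rw [← Real.rpow_mul_natCast hρ.le, ← Real.rpow_add hρ]
    congr 1
    push_cast
    ring
  have hmin : ∀ {ρ : ℝ}, 0 < ρ → 0 ≤ min (ρ ^ c) (ρ ^ d) := fun hρ =>
    le_min (by positivity) (by positivity)
  rw [← Set.Ioc_union_Ioi_eq_Ioi zero_le_one]
  refine IntegrableOn.union ?_ ?_
  · have h1 : IntegrableOn (fun ρ : ℝ => ρ ^ (2 * c + e)) (Set.Ioc 0 1) :=
      (intervalIntegrable_iff_integrableOn_Ioc_of_le zero_le_one).1
        (intervalIntegral.intervalIntegrable_rpow' hc)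
    refine Integrable.mono' h1 hm.aestronglyMeasurable ?_
    filter_upwards [ae_restrict_mem measurableSet_Ioc] with ρ hρ
    have h0 := hmin hρ.1
    have h2 := hρ.1
    rw [Real.norm_of_nonneg (by positivity), ← hsq c hρ.1]
    gcongr
    exact min_le_left _ _
  · refine Integrable.mono' (integrableOn_Ioi_rpow_of_lt hd one_pos) hm.aestronglyMeasurable ?_
    filter_upwards [ae_restrict_mem measurableSet_Ioi] with ρ hρ
    have h2 : 0 < ρ := one_pos.trans hρ
    have h0 := hmin h2
    rw [Real.norm_of_nonneg (by positivity), ← hsq d h2]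
    gcongr
    exact min_le_right _ _

theorem stmt_18 (n : ℕ) (hn : 2 ≤ n) (s : ℝ) (hs0 : 0 < s) (hs1 : s < 1)
    (f : SchwartzMap (EuclideanSpace ℝ (Fin n)) ℝ) :
    ∀ ε > (0 : ℝ), ∃ g : EuclideanSpace ℝ (Fin n) × ℝ → ℝ,
      ContDiff ℝ (⊤ : ℕ∞) g ∧ HasCompactSupport g ∧
      (∫ ρ in Set.Ioi (0 : ℝ), ∫ x : EuclideanSpace ℝ (Fin n),
          (‖fderiv ℝ (fun x' => U18 n s (⇑f) x' ρ - g (x', ρ)) x‖ ^ 2 +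
            (deriv (fun r => U18 n s (⇑f) x r - g (x, r)) ρ) ^ 2) * ρ ^ (1 - s)) < ε := by
  intro ε hε
  have : NeZero n := ⟨by omega⟩
  have hn2 : (2 : ℝ) ≤ n := by exact_mod_cast hn
  set b₁ : ℝ := n - 1 + 3 * s / 4 with hb₁
  set b₂ : ℝ := n - 1 + s / 4 with hb₂
  obtain ⟨C₁, hC₁, h₁⟩ := exists_bound_U18 n hs0 f (b := b₁) (by linarith) (by linarith)
    (by linarith)
  obtain ⟨C₂, hC₂, h₂⟩ := exists_bound_U18 n hs0 f (b := b₂) (by linarith) (by linarith)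
    (by linarith)
  set C := max C₁ C₂
  have hC : 0 ≤ C := hC₁.trans (le_max_left _ _)
  set β : ℝ → ℝ := fun ρ => C * min (ρ ^ (b₁ - n)) (ρ ^ (b₂ - n)) with hβ
  set w : EuclideanSpace ℝ (Fin n) → ℝ := fun x => (1 + ‖x‖) ^ (-b₂) with hw
  have hmin : ∀ {a : ℝ} {p : EuclideanSpace ℝ (Fin n) × ℝ}, 0 < p.2 →
      a ≤ C₁ * (p.2 ^ (b₁ - n) * (1 + ‖p.1‖) ^ (-b₁)) →
      a ≤ C₂ * (p.2 ^ (b₂ - n) * (1 + ‖p.1‖) ^ (-b₂)) → a ≤ β p.2 * w p.1 := by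
    intro a p hp ha₁ ha₂
    have h0 : 0 ≤ w p.1 := by positivity
    have h1 : (1 + ‖p.1‖) ^ (-b₁) ≤ w p.1 :=
      Real.rpow_le_rpow_of_exponent_le (by linarith [norm_nonneg p.1]) (by linarith)
    rw [hβ, mul_assoc, min_mul_of_nonneg _ _ h0, mul_min_of_nonneg _ _ hC]
    refine le_min (ha₁.trans ?_) (ha₂.trans ?_)
    · gcongr
      exact le_max_left _ _
    · gcongr
      exact le_max_right _ _
  refine exists_contDiff_hasCompactSupport_integral_lt
    (W := fun p : EuclideanSpace ℝ (Fin n) × ℝ => U18 n s f p.1 p.2) (β := β) (w := w)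
    (ω := fun ρ => ρ ^ (1 - s)) (fun p hp => contDiffAt_U18 n s f hp)
    (fun δ hδ => contDiff_U18_sqrt n s f hδ) ?_ (fun x => by positivity)
    (fun p hp => ⟨hmin hp (h₁ p hp).1 (h₂ p hp).1, hmin hp (h₁ p hp).2 (h₂ p hp).2⟩)
    (by fun_prop) (fun ρ hρ => by positivity) ?_ ?_ hε
  · intro x hx y _ hxy
    refine mul_le_mul_of_nonneg_left (min_le_min ?_ ?_) hC <;>
      exact Real.rpow_le_rpow_of_nonpos hx hxy (by linarith)
  · have h := (integrableOn_min_rpow_sq_mul_rpow (c := b₁ - n) (d := b₂ - n) (e := 1 - s)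
      (by linarith) (by linarith)).const_mul (C ^ 2)
    simpa only [IntegrableOn, hβ, mul_pow, mul_assoc] using h
  · have h := integrable_one_add_norm (E := EuclideanSpace ℝ (Fin n)) (μ := volume)
      (r := b₂ * 2) (by rw [finrank_euclideanSpace_fin]; linarith)
    refine h.congr (.of_forall fun x => ?_)
    simp only [hw]
    rw [← Real.rpow_mul_natCast (by positivity)]
    simp
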